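/- Let z₁, z₂, z₃ be pairwise distinct complex numbers. The points z₁, z₂, z₃ are collinear (i.e., (z₃ − z₁)/(z₂ − z₁) is a real number) if and only if j(z₁, z₂, z₃) is real and j(z₁, z₂, z₃) ≥ 1. -/

import Mathlib

open Complex

/-- The j-invariant as a function of the cross-ratio. -/
noncomputable def Jfun (l : ℂ) : ℂ := 4 * (l ^ 2 - l + 1) ^ 3 / (27 * l ^ 2 * (l - 1) ^ 2)

/-- The cross-ratio of four points of `ℂ`. -/
noncomputable def crossRatio (z1 z2 z3 z4 : ℂ) : ℂ :=
  ((z1 - z3) / (z2 - z3)) * ((z2 - z4) / (z1 - z4))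

/-- The j-invariant of a quadruple of points of `ℂ`. -/
noncomputable def jInv4 (z1 z2 z3 z4 : ℂ) : ℂ := Jfun (crossRatio z1 z2 z3 z4)

/-- The j-invariant of a triple of points of `ℂ` (fourth point at infinity). -/
noncomputable def jInv3 (z1 z2 z3 : ℂ) : ℂ := Jfun ((z1 - z3) / (z2 - z3))

theorem collinear_iff_jInv3_real_ge_one (z1 z2 z3 : ℂ)
    (h12 : z1 ≠ z2) (h13 : z1 ≠ z3) (h23 : z2 ≠ z3) :
    ((z3 - z1) / (z2 - z1)).im = 0 ↔
      ((jInv3 z1 z2 z3).im = 0 ∧ 1 ≤ (jInv3 z1 z2 z3).re) := by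
  have a12 : z2 - z1 ≠ 0 := sub_ne_zero.mpr h12.symm
  have a13 : z1 - z3 ≠ 0 := sub_ne_zero.mpr h13
  have a23 : z2 - z3 ≠ 0 := sub_ne_zero.mpr h23
  unfold jInv3
  obtain ⟨l, hl⟩ : ∃ l, l = (z1 - z3) / (z2 - z3) := ⟨_, rfl⟩
  have hz : z1 - z3 = l * (z2 - z3) := by rw [hl]; field_simp
  have l0 : l ≠ 0 := by rintro rfl; exact a13 (by simpa using hz)
  have l1 : l - 1 ≠ 0 := by
    intro h
    apply a12
    linear_combination -hz - (z2 - z3) * h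
  have hm : (z3 - z1) / (z2 - z1) = 1 + (l - 1)⁻¹ := by
    rw [div_eq_iff a12]
    field_simp
    linear_combination hz
  obtain ⟨w, hw⟩ : ∃ w, w = 2 * l - 1 - 2 * l⁻¹ - 2 * (l - 1)⁻¹ := ⟨_, rfl⟩
  have hJ : Jfun l = 1 + ((1 / 27 : ℝ) : ℂ) * (w * w) := by
    rw [hw]
    unfold Jfun
    push_cast
    field_simp
    ring
  have p0 : 0 < Complex.normSq l := Complex.normSq_pos.mpr l0
  have p1 : 0 < Complex.normSq (l - 1) := Complex.normSq_pos.mpr l1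
  have hwim : w.im = l.im * (2 + 2 / Complex.normSq l + 2 / Complex.normSq (l - 1)) := by
    rw [hw]
    simp
    ring
  have hpos : 0 < 2 + 2 / Complex.normSq l + 2 / Complex.normSq (l - 1) := by positivity
  have e1 : ((z3 - z1) / (z2 - z1)).im = 0 ↔ w.im = 0 := by
    rw [hm, hwim]
    simp [hpos.ne', l1]
  rw [e1, ← hl, hJ]
  have him : (1 + ((1 / 27 : ℝ) : ℂ) * (w * w)).im = 2 / 27 * (w.re * w.im) := by
    rw [Complex.add_im, Complex.im_ofReal_mul, Complex.mul_im, Complex.one_im]; ring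
  have hre : (1 + ((1 / 27 : ℝ) : ℂ) * (w * w)).re = 1 + (w.re ^ 2 - w.im ^ 2) / 27 := by
    rw [Complex.add_re, Complex.re_ofReal_mul, Complex.mul_re, Complex.one_re]; ring
  rw [him, hre]
  constructor
  · intro h
    rw [h]
    exact ⟨by ring, by nlinarith [sq_nonneg w.re]⟩
  · rintro ⟨h1, h2⟩
    have h3 : w.re * w.im = 0 := by linarith
    rcases mul_eq_zero.mp h3 with h | h
    · rw [h] at h2
      exact pow_eq_zero_iff (two_ne_zero) |>.mp (le_antisymm (by linarith) (sq_nonneg w.im))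
    · exact h
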